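/- For all units c, d ∈ (ℤ/p^nℤ)^×, writing m := ⌈n/2⌉, the terms of the partial Kloosterman-type sum indexed by a whose square is not congruent to d cancel: Σ_{a ∈ (ℤ/p^nℤ)^×, a ≡ c mod p^{n₀}, a² ≢ d mod p^{n−m}} e((a + a^{−1}d)/p^n) = 0; equivalently, Σ_{a ≡ c mod p^{n₀}} e((a + a^{−1}d)/p^n) = Σ_{a ≡ c mod p^{n₀}, a² ≡ d mod p^{n−m}} e((a + a^{−1}d)/p^n), all sums ranging over (ℤ/p^nℤ)^×. -/

import Mathlib

open Complex

/-- `e x = exp(2πi x)` for a rational number `x`. -/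
noncomputable def e (x : ℚ) : ℂ := Complex.exp (2 * Real.pi * Complex.I * x)

lemma e_val_eq (N : ℕ) [NeZero N] (x : ZMod N) :
    e ((x.val : ℚ) / (N : ℚ)) = ZMod.stdAddChar x := by
  have h := ZMod.stdAddChar_coe (N := N) (x.val : ℤ)
  have h2 : (((x.val : ℤ)) : ZMod N) = x := by simp
  rw [h2] at h
  rw [h, e]
  congr 1
  push_cast
  ring

lemma castHom_eq_zero_of_pow_mul (p n m : ℕ) (hp : 0 < p) (hm : m ≤ n) (y : ZMod (p ^ n))
    (h : (p : ZMod (p ^ n)) ^ m * y = 0) :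
    ZMod.castHom (pow_dvd_pow p (Nat.sub_le n m)) (ZMod (p ^ (n - m))) y = 0 := by
  haveI : NeZero (p ^ n) := ⟨(pow_pos hp n).ne'⟩
  obtain ⟨k, rfl⟩ : ∃ k : ℕ, (k : ZMod (p ^ n)) = y := ⟨y.val, by simp⟩
  rw [map_natCast, ZMod.natCast_eq_zero_iff]
  have h1 : ((p ^ m * k : ℕ) : ZMod (p ^ n)) = 0 := by push_cast; exact h
  rw [ZMod.natCast_eq_zero_iff] at h1
  have h2 : p ^ n = p ^ m * p ^ (n - m) := by rw [← pow_add]; congr 1; omega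
  rw [h2] at h1
  exact Nat.dvd_of_mul_dvd_mul_left (pow_pos hp m) h1

lemma sum_vanish (N : ℕ) [NeZero N] (q : ZMod N) (hq : q * q = 0) (d : (ZMod N)ˣ)
    (S : Finset (ZMod N)ˣ)
    (hS : ∀ a ∈ S, ∀ u : (ZMod N)ˣ, ∀ t : ZMod N, (u : ZMod N) = 1 + q * t → a * u ∈ S)
    (hne : ∀ a ∈ S, q * ((a : ZMod N) - ((a⁻¹ * d : (ZMod N)ˣ) : ZMod N)) ≠ 0) :
    ∑ a ∈ S, ZMod.stdAddChar (N := N) ((a : ZMod N) + ((a⁻¹ * d : (ZMod N)ˣ) : ZMod N)) = 0 := by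
  classical
  let u : ZMod N → (ZMod N)ˣ := fun t =>
    ⟨1 + q * t, 1 - q * t, by linear_combination (-t^2) * hq, by linear_combination (-t^2) * hq⟩
  have hu : ∀ t, ((u t : (ZMod N)ˣ) : ZMod N) = 1 + q * t := fun t => rfl
  have hui : ∀ t, (((u t)⁻¹ : (ZMod N)ˣ) : ZMod N) = 1 - q * t := fun t => rfl
  have hshift : ∀ t : ZMod N,
      ∑ a ∈ S, ZMod.stdAddChar (N := N) ((a : ZMod N) + ((a⁻¹ * d : (ZMod N)ˣ) : ZMod N)) =
      ∑ a ∈ S, ZMod.stdAddChar (N := N) ((a : ZMod N) + ((a⁻¹ * d : (ZMod N)ˣ) : ZMod N)) *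
        ZMod.stdAddChar (N := N) (t * (q * ((a : ZMod N) - ((a⁻¹ * d : (ZMod N)ˣ) : ZMod N)))) := by
    intro t
    symm
    refine Finset.sum_bij' (fun a _ => a * u t) (fun a _ => a * (u t)⁻¹)
      (fun a ha => hS a ha _ t (hu t))
      (fun a ha => hS a ha _ (-t) (by rw [hui]; ring)) (by simp) (by simp) ?_
    intro a ha
    rw [← AddChar.map_add_eq_mul]
    congr 1
    rw [mul_inv]
    push_cast
    rw [hu, hui]
    ring
  have hsum : (N : ℂ) * ∑ a ∈ S, ZMod.stdAddChar (N := N)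
      ((a : ZMod N) + ((a⁻¹ * d : (ZMod N)ˣ) : ZMod N)) = 0 := by
    calc _ = ∑ t : ZMod N, ∑ a ∈ S, ZMod.stdAddChar (N := N)
          ((a : ZMod N) + ((a⁻¹ * d : (ZMod N)ˣ) : ZMod N)) := by simp [ZMod.card]
      _ = _ := Finset.sum_congr rfl fun t _ => hshift t
      _ = _ := Finset.sum_comm
      _ = 0 := by
        refine Finset.sum_eq_zero fun a ha => ?_
        rw [← Finset.mul_sum, AddChar.sum_mulShift _ (ZMod.isPrimitive_stdAddChar N),
          if_neg (hne a ha)]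
        simp
  exact (mul_eq_zero.mp hsum).resolve_left (Nat.cast_ne_zero.mpr (NeZero.ne N))

/-- for an odd prime `p`, `⌈n/2⌉ ≥ n₀ ≥ 1`, `m := ⌈n/2⌉`, and units `c, d` of
`ℤ/p^nℤ`, the terms of the partial Kloosterman-type sum indexed by `a` with `a² ≢ d (mod
p^{n−m})` cancel, i.e. sum to `0`; equivalently, the sum over `a ≡ c (p^{n₀})` equals the sum
over `a ≡ c (p^{n₀})`, `a² ≡ d (p^{n−m})`. -/
theorem stmt_5 (p n n₀ : ℕ) [hp : Fact p.Prime] (hodd : Odd p)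
    (hn₀ : 0 < n₀) (hn : n₀ ≤ (n + 1) / 2)
    (c d : (ZMod (p ^ n))ˣ) :
    (∑ a ∈ Finset.univ.filter (fun a : (ZMod (p ^ n))ˣ =>
        ZMod.castHom (pow_dvd_pow p (by omega : n₀ ≤ n)) (ZMod (p ^ n₀)) (a : ZMod (p ^ n)) =
          ZMod.castHom (pow_dvd_pow p (by omega : n₀ ≤ n)) (ZMod (p ^ n₀)) (c : ZMod (p ^ n)) ∧
        ZMod.castHom (pow_dvd_pow p (by omega : n - (n + 1) / 2 ≤ n)) (ZMod (p ^ (n - (n + 1) / 2)))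
            (((a : ZMod (p ^ n))) ^ 2) ≠
          ZMod.castHom (pow_dvd_pow p (by omega : n - (n + 1) / 2 ≤ n)) (ZMod (p ^ (n - (n + 1) / 2)))
            (d : ZMod (p ^ n))),
      e ((((a : ZMod (p ^ n)) + ((a⁻¹ * d : (ZMod (p ^ n))ˣ) : ZMod (p ^ n))).val : ℚ) /
        (p ^ n : ℚ))) = 0 ∧
    (∑ a ∈ Finset.univ.filter (fun a : (ZMod (p ^ n))ˣ =>
        ZMod.castHom (pow_dvd_pow p (by omega : n₀ ≤ n)) (ZMod (p ^ n₀)) (a : ZMod (p ^ n)) =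
          ZMod.castHom (pow_dvd_pow p (by omega : n₀ ≤ n)) (ZMod (p ^ n₀)) (c : ZMod (p ^ n))),
      e ((((a : ZMod (p ^ n)) + ((a⁻¹ * d : (ZMod (p ^ n))ˣ) : ZMod (p ^ n))).val : ℚ) /
        (p ^ n : ℚ))) =
    (∑ a ∈ Finset.univ.filter (fun a : (ZMod (p ^ n))ˣ =>
        ZMod.castHom (pow_dvd_pow p (by omega : n₀ ≤ n)) (ZMod (p ^ n₀)) (a : ZMod (p ^ n)) =
          ZMod.castHom (pow_dvd_pow p (by omega : n₀ ≤ n)) (ZMod (p ^ n₀)) (c : ZMod (p ^ n)) ∧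
        ZMod.castHom (pow_dvd_pow p (by omega : n - (n + 1) / 2 ≤ n)) (ZMod (p ^ (n - (n + 1) / 2)))
            (((a : ZMod (p ^ n))) ^ 2) =
          ZMod.castHom (pow_dvd_pow p (by omega : n - (n + 1) / 2 ≤ n)) (ZMod (p ^ (n - (n + 1) / 2)))
            (d : ZMod (p ^ n))),
      e ((((a : ZMod (p ^ n)) + ((a⁻¹ * d : (ZMod (p ^ n))ˣ) : ZMod (p ^ n))).val : ℚ) /
        (p ^ n : ℚ))) := by
  have hppos : 0 < p := hp.out.pos
  haveI : NeZero (p ^ n) := ⟨(pow_pos hppos n).ne'⟩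
  have he : ∀ x : ZMod (p ^ n), e ((x.val : ℚ) / (p ^ n : ℚ)) = ZMod.stdAddChar x := by
    intro x
    rw [← e_val_eq]
    push_cast
    rfl
  simp only [he]
  have hq0 : ∀ k (hk : k ≤ n), k ≤ (n + 1) / 2 → ∀ t : ZMod (p ^ n),
      ZMod.castHom (pow_dvd_pow p hk) (ZMod (p ^ k)) (1 + (p : ZMod (p ^ n)) ^ ((n + 1) / 2) * t)
        = 1 := by
    intro k hk hk2 t
    have : ((p : ZMod (p ^ k))) ^ ((n + 1) / 2) = 0 := by
      have := (ZMod.natCast_eq_zero_iff (p ^ ((n + 1) / 2)) (p ^ k)).mpr (pow_dvd_pow p hk2)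
      exact_mod_cast this
    rw [map_add, map_mul, map_pow, map_natCast, this, map_one, zero_mul, add_zero]
  have key := sum_vanish (p ^ n) ((p : ZMod (p ^ n)) ^ ((n + 1) / 2)) ?_ d
    (Finset.univ.filter (fun a : (ZMod (p ^ n))ˣ =>
        ZMod.castHom (pow_dvd_pow p (by omega : n₀ ≤ n)) (ZMod (p ^ n₀)) (a : ZMod (p ^ n)) =
          ZMod.castHom (pow_dvd_pow p (by omega : n₀ ≤ n)) (ZMod (p ^ n₀)) (c : ZMod (p ^ n)) ∧
        ZMod.castHom (pow_dvd_pow p (by omega : n - (n + 1) / 2 ≤ n)) (ZMod (p ^ (n - (n + 1) / 2)))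
            (((a : ZMod (p ^ n))) ^ 2) ≠
          ZMod.castHom (pow_dvd_pow p (by omega : n - (n + 1) / 2 ≤ n)) (ZMod (p ^ (n - (n + 1) / 2)))
            (d : ZMod (p ^ n)))) ?_ ?_
  · refine ⟨key, ?_⟩
    rw [← Finset.sum_filter_add_sum_filter_not (Finset.univ.filter (fun a : (ZMod (p ^ n))ˣ =>
        ZMod.castHom (pow_dvd_pow p (by omega : n₀ ≤ n)) (ZMod (p ^ n₀)) (a : ZMod (p ^ n)) =
          ZMod.castHom (pow_dvd_pow p (by omega : n₀ ≤ n)) (ZMod (p ^ n₀)) (c : ZMod (p ^ n))))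
      (fun a : (ZMod (p ^ n))ˣ =>
        ZMod.castHom (pow_dvd_pow p (by omega : n - (n + 1) / 2 ≤ n)) (ZMod (p ^ (n - (n + 1) / 2)))
            (((a : ZMod (p ^ n))) ^ 2) =
          ZMod.castHom (pow_dvd_pow p (by omega : n - (n + 1) / 2 ≤ n)) (ZMod (p ^ (n - (n + 1) / 2)))
            (d : ZMod (p ^ n))), Finset.filter_filter, Finset.filter_filter]
    exact (congrArg _ key).trans (add_zero _)
  · have := (ZMod.natCast_eq_zero_iff (p ^ ((n + 1) / 2 + (n + 1) / 2)) (p ^ n)).mpr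
      (pow_dvd_pow p (by omega))
    rw [← pow_add]
    exact_mod_cast this
  · intro a ha u t hu
    simp only [Finset.mem_filter, Finset.mem_univ, true_and] at ha ⊢
    rw [Units.val_mul, mul_pow, map_mul, map_mul, map_pow _ (u : ZMod (p ^ n)), hu,
      hq0 n₀ (by omega) hn t, hq0 (n - (n + 1) / 2) (by omega) (by omega) t, one_pow, mul_one,
      mul_one]
    exact ha
  · intro a ha h0
    simp only [Finset.mem_filter, Finset.mem_univ, true_and] at ha
    apply ha.2
    have h1 := castHom_eq_zero_of_pow_mul p n ((n + 1) / 2) hppos (by omega) _ h0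
    have h2 : (a : ZMod (p ^ n)) ^ 2 =
        a * ((a : ZMod (p ^ n)) - ((a⁻¹ * d : (ZMod (p ^ n))ˣ) : ZMod (p ^ n))) + d := by
      rw [mul_sub, ← Units.val_mul, ← Units.val_mul, mul_inv_cancel_left]
      push_cast
      ring
    rw [h2, map_add, map_mul, h1, mul_zero, zero_add]
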